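/- arXiv:1202.0065 — 2 statements merged into one kernel-verified Lean document; each statement's English description precedes it below -/
import Mathlib

section
/- Let (a₁,a₂,a₃) and (b₁,b₂,b₃) be two bases of the 3-dimensional ℂ-vector space of linear forms in ℂ[X,Y,Z]. Then the ℂ-vector space of tuples (v₁,v₂,v₃,u₁,u₂,u₃) of linear forms satisfying vᵢ·aⱼ + bᵢ·uⱼ = 0 for all 1 ≤ i,j ≤ 3 is one-dimensional, spanned by (b₁,b₂,b₃,−a₁,−a₂,−a₃). (This is the kernel computation underlying the fibre ℙ³⁶ in the geometric quotient description of the codimension-1 stratum X₁₀ of M_{P²}(6,3).) -/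
open MvPolynomial

abbrev R3 := MvPolynomial (Fin 3) ℂ

theorem dvd_linear {p q : R3} (hp : p.IsHomogeneous 1) (hq : q.IsHomogeneous 1)
    (hp0 : p ≠ 0) (h : p ∣ q) : ∃ c : ℂ, q = c • p := by
  obtain ⟨r, rfl⟩ := h
  by_cases hr : r = 0
  · exact ⟨0, by simp [hr]⟩
  have h1 := totalDegree_mul_of_isDomain hp0 hr
  rw [hq.totalDegree (mul_ne_zero hp0 hr), hp.totalDegree hp0] at h1
  have h2 := (totalDegree_eq_zero_iff_eq_C (p := r)).mp (by omega)
  refine ⟨r.coeff 0, ?_⟩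
  rw [smul_eq_C_mul, ← h2, mul_comm]

theorem prime_linear {p : R3} (hp : p.IsHomogeneous 1) (hp0 : p ≠ 0) : Prime p := by
  apply Irreducible.prime
  apply irreducible_of_totalDegree_eq_one (hp.totalDegree hp0)
  intro x hx
  rw [isUnit_iff_ne_zero]
  rintro rfl
  apply hp0
  ext i
  simpa using hx i

/-- Let `(a₁,a₂,a₃)` and `(b₁,b₂,b₃)` be bases of the space of linear forms in `ℂ[X,Y,Z]`.
The space of tuples `(v₁,v₂,v₃,u₁,u₂,u₃)` of linear forms with `vᵢ·aⱼ + bᵢ·uⱼ = 0` for all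
`i,j` is one-dimensional, spanned by `(b₁,b₂,b₃,−a₁,−a₂,−a₃)`. -/
theorem stmt1 (a b : Fin 3 → R3)
    (haL : ∀ i, (a i).IsHomogeneous 1) (hbL : ∀ i, (b i).IsHomogeneous 1)
    (haI : LinearIndependent ℂ a) (hbI : LinearIndependent ℂ b)
    (haS : ∀ p : R3, p.IsHomogeneous 1 → p ∈ Submodule.span ℂ (Set.range a))
    (hbS : ∀ p : R3, p.IsHomogeneous 1 → p ∈ Submodule.span ℂ (Set.range b)) :
    {p : (Fin 3 → R3) × (Fin 3 → R3) |
        (∀ i, (p.1 i).IsHomogeneous 1) ∧ (∀ i, (p.2 i).IsHomogeneous 1) ∧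
        ∀ i j, p.1 i * a j + b i * p.2 j = 0}
      = {p : (Fin 3 → R3) × (Fin 3 → R3) | ∃ c : ℂ, p = (c • b, -(c • a))} := by
  have ha0 : ∀ i, a i ≠ 0 := fun i => haI.ne_zero i
  have hb0 : ∀ i, b i ≠ 0 := fun i => hbI.ne_zero i
  ext ⟨v, u⟩
  simp only [Set.mem_setOf_eq, Prod.mk.injEq]
  constructor
  · rintro ⟨hv, hu, h⟩
    have key : ∀ i k, v i * b k = v k * b i := by
      intro i k
      apply mul_right_cancel₀ (ha0 0)
      linear_combination b k * h i 0 - b i * h k 0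
    have hd : b 0 ∣ v 0 := by
      have h1 : b 0 ∣ v 0 * b 1 := ⟨v 1, by rw [key 0 1, mul_comm]⟩
      rcases (prime_linear (hbL 0) (hb0 0)).dvd_or_dvd h1 with h2 | h2
      · exact h2
      · exfalso
        obtain ⟨c, hc⟩ := dvd_linear (hbL 0) (hbL 1) (hb0 0) h2
        have h3 := Fintype.linearIndependent_iff.mp hbI ![c, -1, 0]
          (by simp [Fin.sum_univ_three, hc]) 1
        simp at h3
    obtain ⟨c, hc⟩ := dvd_linear (hbL 0) (hv 0) (hb0 0) hd
    refine ⟨c, ?_, ?_⟩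
    · funext k
      apply mul_right_cancel₀ (hb0 0)
      rw [← key 0 k, hc]
      simp only [Pi.smul_apply, smul_eq_C_mul]
      ring
    · funext j
      apply mul_left_cancel₀ (hb0 0)
      have := h 0 j
      rw [hc] at this
      simp only [Pi.smul_apply, Pi.neg_apply, smul_eq_C_mul] at this ⊢
      linear_combination this
  · rintro ⟨c, rfl, rfl⟩
    have hs : ∀ (c : ℂ) (p : R3), p.IsHomogeneous 1 → (c • p).IsHomogeneous 1 := by
      intro c p hp
      exact (homogeneousSubmodule (Fin 3) ℂ 1).smul_mem c hp
    refine ⟨fun i => hs c _ (hbL i), fun i => ?_, fun i j => ?_⟩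
    · simpa using hs (-c) _ (haL i)
    · simp only [Pi.smul_apply, Pi.neg_apply, smul_eq_C_mul]
      ring
end

section
/- Let φ₁₁ be a 2×3 matrix of linear forms in ℂ[X,Y,Z] whose three maximal (2×2) minors are linearly independent over ℂ, and let φ₂₂ be a 3×2 matrix of linear forms whose three maximal (2×2) minors are linearly independent over ℂ. Let K(φ₁₁,φ₂₂) be the ℂ-vector space of pairs (u,v), where u is a 2×3 matrix of linear forms and v is a 3×2 matrix of linear forms, satisfying v·φ₁₁ + φ₂₂·u = 0. Then dim_ℂ K(φ₁₁,φ₂₂) = 4; in particular this dimension is independent of the choice of (φ₁₁,φ₂₂). (This is the key lemma in the proof that Σ is a sub-bundle, yielding the fibre-bundle description of the stratum X₂ of M_{P²}(6,3) over N(3,3,2) × N(3,2,3) with fibre ℙ²¹.) -/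
open MvPolynomial

/-- The three maximal (2×2) minors of a 2×3 matrix. -/
noncomputable def minors23 (φ : Matrix (Fin 2) (Fin 3) R3) : Fin 3 → R3 :=
  ![φ 0 1 * φ 1 2 - φ 0 2 * φ 1 1,
    φ 0 0 * φ 1 2 - φ 0 2 * φ 1 0,
    φ 0 0 * φ 1 1 - φ 0 1 * φ 1 0]

/-- The three maximal (2×2) minors of a 3×2 matrix. -/
noncomputable def minors32 (φ : Matrix (Fin 3) (Fin 2) R3) : Fin 3 → R3 :=
  ![φ 1 0 * φ 2 1 - φ 1 1 * φ 2 0,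
    φ 0 0 * φ 2 1 - φ 0 1 * φ 2 0,
    φ 0 0 * φ 1 1 - φ 0 1 * φ 1 0]

/-- `(u,v)` is a solution: `u` is a 2×3 matrix of linear forms, `v` a 3×2 matrix of linear
forms, and `v·φ₁₁ + φ₂₂·u = 0`. -/
def IsSol (φ₁₁ : Matrix (Fin 2) (Fin 3) R3) (φ₂₂ : Matrix (Fin 3) (Fin 2) R3)
    (p : Matrix (Fin 2) (Fin 3) R3 × Matrix (Fin 3) (Fin 2) R3) : Prop :=
  (∀ i j, (p.1 i j).IsHomogeneous 1) ∧ (∀ i j, (p.2 i j).IsHomogeneous 1) ∧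
    p.2 * φ₁₁ + φ₂₂ * p.1 = 0

/-- linear independence of three polynomials, in explicit form -/
def Indep3 (m : Fin 3 → R3) : Prop :=
  ∀ a b c : ℂ, C a * m 0 + C b * m 1 + C c * m 2 = 0 → a = 0 ∧ b = 0 ∧ c = 0

lemma Indep3.ne_zero {m : Fin 3 → R3} (h : Indep3 m) (i : Fin 3) : m i ≠ 0 := by
  intro hi
  fin_cases i
  · have := h 1 0 0 (by simpa using hi)
    simp at this
  · have := h 0 1 0 (by simpa using hi)
    simp at this
  · have := h 0 0 1 (by simpa using hi)
    simp at this

lemma indep3_of {m : Fin 3 → R3} (h : LinearIndependent ℂ m) : Indep3 m := by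
  intro a b c habc
  rw [Fintype.linearIndependent_iff] at h
  have := h ![a, b, c] (by simpa [Fin.sum_univ_three, MvPolynomial.smul_eq_C_mul] using habc)
  exact ⟨by simpa using this 0, by simpa using this 1, by simpa using this 2⟩

lemma linear_comp (q : R3) (hq : q.totalDegree ≤ 1) :
    ∃ a : ℂ, ∃ l : R3, l.IsHomogeneous 1 ∧ q = C a + l := by
  refine ⟨coeff 0 q, homogeneousComponent 1 q, homogeneousComponent_isHomogeneous 1 q, ?_⟩
  have h := sum_homogeneousComponent q
  have h2 : ∑ i ∈ Finset.range 2, homogeneousComponent i q = q := by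
    conv_rhs => rw [← h]
    symm
    apply Finset.sum_subset
    · intro i hi; simp at hi ⊢; omega
    · intro i _ hi
      apply homogeneousComponent_eq_zero
      simp at hi; omega
  rw [Finset.sum_range_succ, Finset.sum_range_one, homogeneousComponent_zero] at h2
  exact h2.symm

lemma homog_part {a b : ℂ} {l k m : R3} (hl : l.IsHomogeneous 1) (hk : k.IsHomogeneous 1)
    (hm : m.IsHomogeneous 2) (h : m = (C a + l) * (C b + k)) : m = l * k := by
  have h1 : homogeneousComponent 2 m = m := homogeneousComponent_eq_self hm
  have e : (C a + l) * (C b + k) = C (a * b) + C a * k + C b * l + l * k := by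
    rw [C_mul]; ring
  rw [← h1, h, e, map_add, map_add, map_add,
    homogeneousComponent_of_mem (isHomogeneous_C _ _),
    homogeneousComponent_of_mem (hk.C_mul a), homogeneousComponent_of_mem (hl.C_mul b),
    homogeneousComponent_of_mem (hl.mul hk)]
  simp

lemma common {m f : Fin 3 → R3} (hm : ∀ i, (m i).IsHomogeneous 2)
    (hf : ∀ i, (f i).IsHomogeneous 2) (hi : Indep3 m) (hpar : ∀ i j, f i * m j = f j * m i)
    (nofac : ¬ ∃ (l : R3) (m' : Fin 3 → R3), l.IsHomogeneous 1 ∧ (∀ i, (m' i).IsHomogeneous 1) ∧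
      ∀ i, m i = l * m' i) : ∃ c : ℂ, ∀ i, f i = C c * m i := by
  obtain ⟨p, q, g, hpq, hp, hq⟩ :=
    UniqueFactorizationMonoid.exists_reduced_factors' (f 0) (m 0) (hi.ne_zero 0)
  have hg : g ≠ 0 := by
    rintro rfl
    exact hi.ne_zero 0 (by rw [← hq]; simp)
  have hq0 : q ≠ 0 := by
    rintro rfl
    exact hi.ne_zero 0 (by rw [← hq]; simp)
  have h1 : ∀ i, p * m i = f i * q := by
    intro i
    apply mul_left_cancel₀ hg
    have := hpar 0 i
    rw [← hp, ← hq] at this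
    linear_combination this
  have h2 : ∀ i, q ∣ m i := fun i =>
    hpq.symm.dvd_of_dvd_mul_left ⟨f i, by rw [h1 i]; ring⟩
  choose k hk using h2
  have hk0 : ∀ i, k i ≠ 0 := by
    intro i h
    exact hi.ne_zero i (by rw [hk, h, mul_zero])
  have hfk : ∀ i, f i = p * k i := by
    intro i
    apply mul_left_cancel₀ hq0
    have := h1 i
    rw [hk i] at this
    linear_combination -this
  have hdeg : ∀ i, q.totalDegree + (k i).totalDegree = 2 := by
    intro i
    rw [← totalDegree_mul_of_isDomain hq0 (hk0 i), ← hk i]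
    exact (hm i).totalDegree (hi.ne_zero i)
  have hd0 := hdeg 0
  have hcase : q.totalDegree = 0 ∨ q.totalDegree = 1 ∨ q.totalDegree = 2 := by omega
  rcases hcase with h | h | h
  · have hqc := totalDegree_eq_zero_iff_eq_C.mp h
    set a := coeff 0 q
    have ha : a ≠ 0 := by
      intro ha; rw [ha] at hqc; exact hq0 (by simpa using hqc)
    by_cases hp0 : p = 0
    · exact ⟨0, fun i => by rw [hfk, hp0]; simp⟩
    have hpd : p.totalDegree = 0 := by
      have e := (hf 0).totalDegree (by rw [hfk]; exact mul_ne_zero hp0 (hk0 0))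
      rw [hfk, totalDegree_mul_of_isDomain hp0 (hk0 0)] at e
      omega
    have hpc := totalDegree_eq_zero_iff_eq_C.mp hpd
    set b := coeff 0 p
    refine ⟨b / a, fun i => ?_⟩
    rw [hfk, hk i, hqc, hpc, ← mul_assoc, ← C_mul, div_mul_cancel₀ _ ha]
  · exfalso
    apply nofac
    obtain ⟨a, l, hl, hql⟩ := linear_comp q h.le
    have : ∀ i, ∃ b : ℂ, ∃ l : R3, l.IsHomogeneous 1 ∧ k i = C b + l := by
      intro i
      apply linear_comp
      have := hdeg i
      omega
    choose b n hn hkn using this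
    refine ⟨l, n, hl, hn, fun i => ?_⟩
    apply homog_part hl (hn i) (hm i) (a := a) (b := b i)
    rw [hk i, hkn, hql]
  · exfalso
    have : ∀ i, k i = C (coeff 0 (k i)) := by
      intro i
      apply totalDegree_eq_zero_iff_eq_C.mp
      have := hdeg i
      omega
    have h3 := hi (coeff 0 (k 1)) (-coeff 0 (k 0)) 0 (by
      rw [hk 0, hk 1]
      conv_lhs => rw [this 0, this 1]
      simp
      ring)
    apply hk0 1
    rw [this 1, h3.1, C_0]

/-- The generic case: the minors have no common linear factor. -/
lemma caseB {a b w : Fin 3 → R3} (ha : ∀ i, (a i).IsHomogeneous 1)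
    (hb : ∀ i, (b i).IsHomogeneous 1) (hw : ∀ i, (w i).IsHomogeneous 1)
    (m : Fin 3 → R3) (hm0 : m 0 = a 1 * b 2 - a 2 * b 1) (hm1 : m 1 = a 2 * b 0 - a 0 * b 2)
    (hm2 : m 2 = a 0 * b 1 - a 1 * b 0) (hi : Indep3 m)
    (hwm : w 0 * m 0 + w 1 * m 1 + w 2 * m 2 = 0)
    (nofac : ¬ ∃ (l : R3) (m' : Fin 3 → R3), l.IsHomogeneous 1 ∧ (∀ i, (m' i).IsHomogeneous 1) ∧
      ∀ i, m i = l * m' i) : ∃ x y : ℂ, ∀ i, w i = C x * a i + C y * b i := by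
  have hm : ∀ i, (m i).IsHomogeneous 2 := by
    intro i
    fin_cases i
    · exact hm0 ▸ ((ha 1).mul (hb 2)).sub ((ha 2).mul (hb 1))
    · exact hm1 ▸ ((ha 2).mul (hb 0)).sub ((ha 0).mul (hb 2))
    · exact hm2 ▸ ((ha 0).mul (hb 1)).sub ((ha 1).mul (hb 0))
  have key : ∀ d : Fin 3 → R3, (∀ i, (d i).IsHomogeneous 1) →
      d 0 * m 0 + d 1 * m 1 + d 2 * m 2 = 0 →
      ∃ c : ℂ, d 1 * w 2 - d 2 * w 1 = C c * m 0 ∧ d 2 * w 0 - d 0 * w 2 = C c * m 1 ∧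
        d 0 * w 1 - d 1 * w 0 = C c * m 2 := by
    intro d hd hdm
    obtain ⟨f, f0, f1, f2⟩ : ∃ f : Fin 3 → R3, f 0 = d 1 * w 2 - d 2 * w 1 ∧
        f 1 = d 2 * w 0 - d 0 * w 2 ∧ f 2 = d 0 * w 1 - d 1 * w 0 :=
      ⟨![d 1 * w 2 - d 2 * w 1, d 2 * w 0 - d 0 * w 2, d 0 * w 1 - d 1 * w 0], rfl, rfl, rfl⟩
    have hf : ∀ i, (f i).IsHomogeneous 2 := by
      intro i
      fin_cases i
      · exact f0 ▸ ((hd 1).mul (hw 2)).sub ((hd 2).mul (hw 1))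
      · exact f1 ▸ ((hd 2).mul (hw 0)).sub ((hd 0).mul (hw 2))
      · exact f2 ▸ ((hd 0).mul (hw 1)).sub ((hd 1).mul (hw 0))
    have e01 : f 0 * m 1 = f 1 * m 0 := by
      rw [f0, f1]; linear_combination w 2 * hdm - d 2 * hwm
    have e02 : f 0 * m 2 = f 2 * m 0 := by
      rw [f0, f2]; linear_combination -w 1 * hdm + d 1 * hwm
    have e12 : f 1 * m 2 = f 2 * m 1 := by
      rw [f1, f2]; linear_combination w 0 * hdm - d 0 * hwm
    have hpar : ∀ i j, f i * m j = f j * m i := by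
      intro i j
      fin_cases i
      · fin_cases j
        · rfl
        · exact e01
        · exact e02
      · fin_cases j
        · exact e01.symm
        · rfl
        · exact e12
      · fin_cases j
        · exact e02.symm
        · exact e12.symm
        · rfl
    obtain ⟨c, hc⟩ := common hm hf hi hpar nofac
    exact ⟨c, f0 ▸ hc 0, f1 ▸ hc 1, f2 ▸ hc 2⟩
  obtain ⟨c, c0, c1, c2⟩ := key a ha (by rw [hm0, hm1, hm2]; ring)
  obtain ⟨d, d0, d1, d2⟩ := key b hb (by rw [hm0, hm1, hm2]; ring)
  refine ⟨-d, c, ?_⟩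
  obtain ⟨z, hz⟩ : ∃ z : Fin 3 → R3, ∀ i, z i = w i - (C (-d) * a i + C c * b i) :=
    ⟨_, fun i => rfl⟩
  have hd : (C (-d) : R3) = - C d := by simp
  rw [hm0] at c0 d0
  rw [hm1] at c1 d1
  rw [hm2] at c2 d2
  have a0 : a 1 * z 2 - a 2 * z 1 = 0 := by rw [hz, hz, hd]; linear_combination c0
  have a1 : a 2 * z 0 - a 0 * z 2 = 0 := by rw [hz, hz, hd]; linear_combination c1
  have a2 : a 0 * z 1 - a 1 * z 0 = 0 := by rw [hz, hz, hd]; linear_combination c2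
  have b0 : b 1 * z 2 - b 2 * z 1 = 0 := by rw [hz, hz, hd]; linear_combination d0
  have b1 : b 2 * z 0 - b 0 * z 2 = 0 := by rw [hz, hz, hd]; linear_combination d1
  have b2 : b 0 * z 1 - b 1 * z 0 = 0 := by rw [hz, hz, hd]; linear_combination d2
  have hz0 : ∀ i, z i * m 2 = 0 := by
    intro i
    rw [hm2]
    fin_cases i
    · show z 0 * _ = 0
      linear_combination b 0 * a2 - a 0 * b2
    · show z 1 * _ = 0
      linear_combination b 1 * a2 - a 1 * b2
    · show z 2 * _ = 0
      linear_combination -b 0 * a0 - b 1 * a1 - a 2 * b2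
  intro i
  have := (mul_eq_zero.mp (hz0 i)).resolve_right (hi.ne_zero 2)
  rw [hz] at this
  linear_combination this

lemma linear_form {f : R3} (hf : f.IsHomogeneous 1) :
    ∃ g : Fin 3 → ℂ, ∀ P : Fin 3 → ℂ, eval P f = g ⬝ᵥ P := by
  have h : f ∈ homogeneousSubmodule (Fin 3) ℂ 1 := hf
  rw [homogeneousSubmodule_one_eq_span_X, Submodule.mem_span_range_iff_exists_fun] at h
  obtain ⟨g, hg⟩ := h
  refine ⟨g, fun P => ?_⟩
  rw [← hg]
  simp [dotProduct, smul_eq_C_mul]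

lemma coords {m : Fin 3 → R3} (hm : ∀ i, (m i).IsHomogeneous 1) (hi : Indep3 m) :
    (∀ x : Fin 3 → ℂ, ∃ P : Fin 3 → ℂ, ∀ j, eval P (m j) = x j) ∧
    ∀ f : R3, f.IsHomogeneous 1 →
      ∃ g : Fin 3 → ℂ, f = C (g 0) * m 0 + C (g 1) * m 1 + C (g 2) * m 2 := by
  choose G hG using fun i => linear_form (hm i)
  have hdet : Matrix.det (Matrix.of G) ≠ 0 := by
    intro h0
    obtain ⟨v, hv, hv0⟩ := Matrix.exists_vecMul_eq_zero_iff.mpr h0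
    apply hv
    have := hi (v 0) (v 1) (v 2) (by
      apply MvPolynomial.funext
      intro P
      have h2 : (Matrix.vecMul v (Matrix.of G)) ⬝ᵥ P = 0 := by rw [hv0]; simp
      rw [← Matrix.dotProduct_mulVec] at h2
      simp only [map_add, map_mul, eval_C, hG, map_zero]
      simpa [dotProduct, Fin.sum_univ_three, Matrix.mulVec] using h2)
    ext i
    fin_cases i
    · exact this.1
    · exact this.2.1
    · exact this.2.2
  have hu : IsUnit (Matrix.det (Matrix.of G)) := isUnit_iff_ne_zero.mpr hdet
  constructor
  · intro x
    refine ⟨Matrix.mulVec (Matrix.of G)⁻¹ x, fun j => ?_⟩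
    have : Matrix.mulVec (Matrix.of G) (Matrix.mulVec (Matrix.of G)⁻¹ x) = x := by
      rw [Matrix.mulVec_mulVec, Matrix.mul_nonsing_inv _ hu, Matrix.one_mulVec]
    rw [hG]
    exact congrFun this j
  · intro f hf
    obtain ⟨h, hh⟩ := linear_form hf
    obtain ⟨g, hg⟩ : ∃ g, g = Matrix.vecMul h (Matrix.of G)⁻¹ := ⟨_, rfl⟩
    refine ⟨g, ?_⟩
    apply MvPolynomial.funext
    intro P
    have : g ⬝ᵥ Matrix.mulVec (Matrix.of G) P = h ⬝ᵥ P := by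
      rw [Matrix.dotProduct_mulVec, hg, Matrix.vecMul_vecMul, Matrix.nonsing_inv_mul _ hu,
        Matrix.vecMul_one]
    simp only [map_add, map_mul, eval_C, hG, hh, ← this]
    simp [dotProduct, Fin.sum_univ_three, Matrix.mulVec]

/-- Linear syzygies of three independent linear forms are Koszul. -/
lemma koszul {m w : Fin 3 → R3} (hm : ∀ i, (m i).IsHomogeneous 1) (hi : Indep3 m)
    (hw : ∀ i, (w i).IsHomogeneous 1) (h : w 0 * m 0 + w 1 * m 1 + w 2 * m 2 = 0) :
    ∃ c : Fin 3 → ℂ, w 0 = C (c 1) * m 2 - C (c 2) * m 1 ∧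
      w 1 = C (c 2) * m 0 - C (c 0) * m 2 ∧ w 2 = C (c 0) * m 1 - C (c 1) * m 0 := by
  obtain ⟨hQ, hL⟩ := coords hm hi
  choose M hM using fun i => hL (w i) (hw i)
  have q : ∀ x y z : ℂ,
      (M 0 0 * x + M 0 1 * y + M 0 2 * z) * x + (M 1 0 * x + M 1 1 * y + M 1 2 * z) * y +
      (M 2 0 * x + M 2 1 * y + M 2 2 * z) * z = 0 := by
    intro x y z
    obtain ⟨P, hP⟩ := hQ ![x, y, z]
    have := congrArg (eval P) h
    rw [hM 0, hM 1, hM 2] at this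
    simpa [hP] using this
  have d0 : M 0 0 = 0 := by simpa using q 1 0 0
  have d1 : M 1 1 = 0 := by simpa using q 0 1 0
  have d2 : M 2 2 = 0 := by simpa using q 0 0 1
  have e01 : M 1 0 = - M 0 1 := by linear_combination q 1 1 0 - d0 - d1
  have e02 : M 2 0 = - M 0 2 := by linear_combination q 1 0 1 - d0 - d2
  have e12 : M 2 1 = - M 1 2 := by linear_combination q 0 1 1 - d1 - d2
  refine ⟨![- M 1 2, M 0 2, - M 0 1], ?_, ?_, ?_⟩
  · rw [hM 0, d0]; simp; ring
  · rw [hM 1, d1, e01]; simp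
  · rw [hM 2, d2, e02, e12]; simp; ring

lemma span_aux {s X Y : ℂ} {a b c : Fin 3 → ℂ} (hs : s ≠ 0)
    (h0 : s * c 0 = X * a 0 + Y * b 0) (h1 : s * c 1 = X * a 1 + Y * b 1)
    (h2 : s * c 2 = X * a 2 + Y * b 2) : ∃ x y : ℂ, ∀ i, c i = x * a i + y * b i := by
  refine ⟨X / s, Y / s, fun i => ?_⟩
  rw [div_mul_eq_mul_div, div_mul_eq_mul_div, ← add_div, eq_div_iff hs, mul_comm]
  fin_cases i
  · exact h0
  · exact h1
  · exact h2

/-- A vector orthogonal to a nonzero `a × b` lies in the span of `a` and `b`. -/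
lemma span_of_det {a b c : Fin 3 → ℂ}
    (hs : ¬ (a 1 * b 2 - a 2 * b 1 = 0 ∧ a 2 * b 0 - a 0 * b 2 = 0 ∧ a 0 * b 1 - a 1 * b 0 = 0))
    (h : (a 1 * b 2 - a 2 * b 1) * c 0 + (a 2 * b 0 - a 0 * b 2) * c 1 +
      (a 0 * b 1 - a 1 * b 0) * c 2 = 0) :
    ∃ x y : ℂ, ∀ i, c i = x * a i + y * b i := by
  by_cases h0 : a 1 * b 2 - a 2 * b 1 = 0
  · by_cases h1 : a 2 * b 0 - a 0 * b 2 = 0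
    · have h2 : a 0 * b 1 - a 1 * b 0 ≠ 0 := fun h2 => hs ⟨h0, h1, h2⟩
      refine span_aux h2 (X := c 0 * b 1 - c 1 * b 0) (Y := a 0 * c 1 - a 1 * c 0) ?_ ?_ ?_
      · ring
      · ring
      · linear_combination h
    · refine span_aux h1 (X := c 2 * b 0 - c 0 * b 2) (Y := a 2 * c 0 - a 0 * c 2) ?_ ?_ ?_
      · ring
      · linear_combination h
      · ring
  · refine span_aux h0 (X := c 1 * b 2 - c 2 * b 1) (Y := a 1 * c 2 - a 2 * c 1) ?_ ?_ ?_
    · linear_combination h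
    · ring
    · ring

lemma parallel_of_orth {a b g : Fin 3 → ℂ}
    (hs : ¬ (a 1 * b 2 - a 2 * b 1 = 0 ∧ a 2 * b 0 - a 0 * b 2 = 0 ∧ a 0 * b 1 - a 1 * b 0 = 0))
    (ha : g 0 * a 0 + g 1 * a 1 + g 2 * a 2 = 0) (hb : g 0 * b 0 + g 1 * b 1 + g 2 * b 2 = 0) :
    ∃ k : ℂ, g 0 = k * (a 1 * b 2 - a 2 * b 1) ∧ g 1 = k * (a 2 * b 0 - a 0 * b 2) ∧
      g 2 = k * (a 0 * b 1 - a 1 * b 0) := by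
  have e01 : g 0 * (a 2 * b 0 - a 0 * b 2) = g 1 * (a 1 * b 2 - a 2 * b 1) := by
    linear_combination a 2 * hb - b 2 * ha
  have e02 : g 0 * (a 0 * b 1 - a 1 * b 0) = g 2 * (a 1 * b 2 - a 2 * b 1) := by
    linear_combination -a 1 * hb + b 1 * ha
  have e12 : g 1 * (a 0 * b 1 - a 1 * b 0) = g 2 * (a 2 * b 0 - a 0 * b 2) := by
    linear_combination a 0 * hb - b 0 * ha
  generalize a 1 * b 2 - a 2 * b 1 = s0 at *
  generalize a 2 * b 0 - a 0 * b 2 = s1 at *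
  generalize a 0 * b 1 - a 1 * b 0 = s2 at *
  by_cases h0 : s0 = 0
  · by_cases h1 : s1 = 0
    · have h2 : s2 ≠ 0 := fun h2 => hs ⟨h0, h1, h2⟩
      refine ⟨g 2 / s2, ?_, ?_, ?_⟩ <;> field_simp <;> assumption
    · refine ⟨g 1 / s1, ?_, ?_, ?_⟩ <;> field_simp <;> first | assumption | exact e12.symm
  · refine ⟨g 0 / s0, ?_, ?_, ?_⟩ <;> field_simp <;> first | exact e01.symm | exact e02.symm

/-- The columns of a `3 × 2` matrix with independent minors: no nontrivial constant combination
of them is a multiple of a single polynomial. -/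
lemma no_col {p : Matrix (Fin 3) (Fin 2) R3} (hi : Indep3 (minors32 p)) {x y : ℂ}
    {k : Fin 3 → ℂ} {L : R3} (h : ∀ i, C x * p i 0 + C y * p i 1 = C (k i) * L) :
    x = 0 ∧ y = 0 := by
  by_contra hxy
  have e : ∀ t : ℂ, t = x ∨ t = y → t * k 0 = 0 ∧ t * (- k 1) = 0 ∧ t * k 2 = 0 := by
    intro t ht
    apply hi
    simp only [minors32, C_mul, C_neg, Matrix.cons_val_zero, Matrix.cons_val_one,
      Matrix.cons_val]
    have h0 := h 0
    have h1 := h 1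
    have h2 := h 2
    rcases ht with rfl | rfl
    · linear_combination (C (k 0) * p 2 1 - C (k 2) * p 0 1) * h1 +
        (C (k 2) * p 1 1 - C (k 1) * p 2 1) * h0 + (C (k 1) * p 0 1 - C (k 0) * p 1 1) * h2
    · linear_combination -(C (k 0) * p 2 0 - C (k 2) * p 0 0) * h1 -
        (C (k 2) * p 1 0 - C (k 1) * p 2 0) * h0 - (C (k 1) * p 0 0 - C (k 0) * p 1 0) * h2
  have hk : ∀ i, k i = 0 := by
    by_cases hx : x = 0
    · have hy : y ≠ 0 := fun hy => hxy ⟨hx, hy⟩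
      have := e y (Or.inr rfl)
      intro i
      fin_cases i <;> simp_all
    · have := e x (Or.inl rfl)
      intro i
      fin_cases i <;> simp_all
  have h' : ∀ i, C x * p i 0 + C y * p i 1 = 0 := by
    intro i; rw [h, hk]; simp
  have h0 := h' 0
  have h1 := h' 1
  have f : ∀ t : ℂ, t = x ∨ t = y → t = 0 := by
    intro t ht
    have := hi 0 0 t (by
      simp only [minors32, Matrix.cons_val]
      simp only [C_0, zero_mul, zero_add]
      rcases ht with rfl | rfl
      · linear_combination p 1 1 * h0 - p 0 1 * h1
      · linear_combination p 0 0 * h1 - p 1 0 * h0)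
    exact this.2.2
  exact hxy ⟨f x (Or.inl rfl), f y (Or.inr rfl)⟩

/-- The case of a common linear factor. -/
lemma caseA {a b : Fin 3 → R3} {u : Fin 2 → Fin 3 → R3} {p v : Matrix (Fin 3) (Fin 2) R3}
    (ha : ∀ i, (a i).IsHomogeneous 1)
    (hb : ∀ i, (b i).IsHomogeneous 1) (hu : ∀ j i, (u j i).IsHomogeneous 1)
    (hp : ∀ i j, (p i j).IsHomogeneous 1)
    (m : Fin 3 → R3) (hm0 : m 0 = a 1 * b 2 - a 2 * b 1) (hm1 : m 1 = a 2 * b 0 - a 0 * b 2)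
    (hm2 : m 2 = a 0 * b 1 - a 1 * b 0) (hi : Indep3 m)
    (hum : ∀ j, u j 0 * m 0 + u j 1 * m 1 + u j 2 * m 2 = 0)
    (hpi : Indep3 (minors32 p))
    (heq : ∀ i k, v i 0 * a k + v i 1 * b k + (p i 0 * u 0 k + p i 1 * u 1 k) = 0)
    {l : R3} {n : Fin 3 → R3} (hn : ∀ i, (n i).IsHomogeneous 1)
    (hmn : ∀ i, m i = l * n i) (j : Fin 2) :
    ∃ x y : ℂ, ∀ i, u j i = C x * a i + C y * b i := by
  have hl : l ≠ 0 := by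
    rintro rfl
    exact hi.ne_zero 0 (by rw [hmn]; simp)
  have hni : Indep3 n := by
    intro x y z h
    apply hi
    rw [hmn, hmn, hmn]
    linear_combination l * h
  have can : ∀ w : Fin 3 → R3, w 0 * m 0 + w 1 * m 1 + w 2 * m 2 = 0 →
      w 0 * n 0 + w 1 * n 1 + w 2 * n 2 = 0 := by
    intro w hw
    apply mul_left_cancel₀ hl
    rw [hmn, hmn, hmn] at hw
    linear_combination hw
  obtain ⟨A, A0, A1, A2⟩ := koszul hn hni ha (can a (by rw [hm0, hm1, hm2]; ring))
  obtain ⟨B, B0, B1, B2⟩ := koszul hn hni hb (can b (by rw [hm0, hm1, hm2]; ring))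
  choose c c0 c1 c2 using fun j => koszul hn hni (hu j) (can (u j) (hum j))
  have hs : ¬ (A 1 * B 2 - A 2 * B 1 = 0 ∧ A 2 * B 0 - A 0 * B 2 = 0 ∧
      A 0 * B 1 - A 1 * B 0 = 0) := by
    rintro ⟨s0, s1, s2⟩
    apply hi.ne_zero 0
    have s0' := congrArg (C : ℂ → R3) s0
    have s1' := congrArg (C : ℂ → R3) s1
    have s2' := congrArg (C : ℂ → R3) s2
    simp only [C_sub, C_mul, C_0] at s0' s1' s2'
    rw [hm0, A1, B2, A2, B1]
    linear_combination n 0 * n 0 * s0' + n 0 * n 1 * s1' + n 0 * n 2 * s2'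
  obtain ⟨hQ, hL⟩ := coords hn hni
  obtain ⟨ε, hε⟩ : ∃ ε : Fin 2 → ℂ, ∀ j, ε j = (A 1 * B 2 - A 2 * B 1) * c j 0 +
      (A 2 * B 0 - A 0 * B 2) * c j 1 + (A 0 * B 1 - A 1 * B 0) * c j 2 := ⟨_, fun _ => rfl⟩
  have hcol : ∀ i, ∃ k : ℂ, C (ε 0) * p i 0 + C (ε 1) * p i 1 =
      C k * (C (A 1 * B 2 - A 2 * B 1) * n 0 + C (A 2 * B 0 - A 0 * B 2) * n 1 +
        C (A 0 * B 1 - A 1 * B 0) * n 2) := by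
    intro i
    obtain ⟨g, hg⟩ := hL (C (ε 0) * p i 0 + C (ε 1) * p i 1)
      (((hp i 0).C_mul _).add ((hp i 1).C_mul _))
    have ev : ∀ x : Fin 3 → ℂ, ∃ V0 V1 p0 p1 : ℂ,
        (ε 0 * p0 + ε 1 * p1 = g 0 * x 0 + g 1 * x 1 + g 2 * x 2) ∧
        (V0 * (A 1 * x 2 - A 2 * x 1) + V1 * (B 1 * x 2 - B 2 * x 1) +
          (p0 * (c 0 1 * x 2 - c 0 2 * x 1) + p1 * (c 1 1 * x 2 - c 1 2 * x 1)) = 0) ∧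
        (V0 * (A 2 * x 0 - A 0 * x 2) + V1 * (B 2 * x 0 - B 0 * x 2) +
          (p0 * (c 0 2 * x 0 - c 0 0 * x 2) + p1 * (c 1 2 * x 0 - c 1 0 * x 2)) = 0) ∧
        (V0 * (A 0 * x 1 - A 1 * x 0) + V1 * (B 0 * x 1 - B 1 * x 0) +
          (p0 * (c 0 0 * x 1 - c 0 1 * x 0) + p1 * (c 1 0 * x 1 - c 1 1 * x 0)) = 0) := by
      intro x
      obtain ⟨P, hP⟩ := hQ x
      refine ⟨eval P (v i 0), eval P (v i 1), eval P (p i 0), eval P (p i 1), ?_, ?_, ?_, ?_⟩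
      · simpa [hP] using congrArg (eval P) hg
      · have := congrArg (eval P) (heq i 0)
        rw [A0, B0, c0, c0] at this
        simpa [hP] using this
      · have := congrArg (eval P) (heq i 1)
        rw [A1, B1, c1, c1] at this
        simpa [hP] using this
      · have := congrArg (eval P) (heq i 2)
        rw [A2, B2, c2, c2] at this
        simpa [hP] using this
    obtain ⟨k, k0, k1, k2⟩ := parallel_of_orth (g := g) hs
      (by
        obtain ⟨V0, V1, p0, p1, e, f0, f1, f2⟩ := ev A
        rw [← e, hε, hε]
        linear_combination B 0 * f0 + B 1 * f1 + B 2 * f2)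
      (by
        obtain ⟨V0, V1, p0, p1, e, f0, f1, f2⟩ := ev B
        rw [← e, hε, hε]
        linear_combination -A 0 * f0 - A 1 * f1 - A 2 * f2)
    refine ⟨k, ?_⟩
    rw [hg, k0, k1, k2]
    simp only [C_mul]
    ring
  choose k hk using hcol
  have hε0 := no_col hpi hk
  have hεj : ε j = 0 := by
    fin_cases j
    · exact hε0.1
    · exact hε0.2
  rw [hε] at hεj
  obtain ⟨x, y, hxy⟩ := span_of_det hs hεj
  refine ⟨x, y, fun i => ?_⟩
  fin_cases i
  · show u j 0 = C x * a 0 + C y * b 0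
    rw [c0, A0, B0, hxy, hxy]; simp only [C_add, C_mul]; ring
  · show u j 1 = C x * a 1 + C y * b 1
    rw [c1, A1, B1, hxy, hxy]; simp only [C_add, C_mul]; ring
  · show u j 2 = C x * a 2 + C y * b 2
    rw [c2, A2, B2, hxy, hxy]; simp only [C_add, C_mul]; ring

/-- a constant matrix, seen as a matrix of polynomials -/
noncomputable def cmat (A : Matrix (Fin 2) (Fin 2) ℂ) : Matrix (Fin 2) (Fin 2) R3 :=
  Matrix.of fun i j => C (A i j)

lemma cmat_apply (A : Matrix (Fin 2) (Fin 2) ℂ) (i j : Fin 2) : cmat A i j = C (A i j) := rfl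

/-- Every solution is trivial. -/
lemma sol_trivial {φ : Matrix (Fin 2) (Fin 3) R3} {p : Matrix (Fin 3) (Fin 2) R3}
    (hφ : ∀ i j, (φ i j).IsHomogeneous 1) (hp : ∀ i j, (p i j).IsHomogeneous 1)
    (hφm : Indep3 (minors23 φ)) (hpm : Indep3 (minors32 p))
    {u : Matrix (Fin 2) (Fin 3) R3} {v : Matrix (Fin 3) (Fin 2) R3}
    (hu : ∀ i j, (u i j).IsHomogeneous 1) (h : v * φ + p * u = 0) :
    ∃ A : Matrix (Fin 2) (Fin 2) ℂ, u = cmat A * φ ∧ v = -(p * cmat A) := by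
  obtain ⟨m, hm0, hm1, hm2⟩ : ∃ m : Fin 3 → R3,
      m 0 = φ 0 1 * φ 1 2 - φ 0 2 * φ 1 1 ∧ m 1 = φ 0 2 * φ 1 0 - φ 0 0 * φ 1 2 ∧
      m 2 = φ 0 0 * φ 1 1 - φ 0 1 * φ 1 0 :=
    ⟨![φ 0 1 * φ 1 2 - φ 0 2 * φ 1 1, φ 0 2 * φ 1 0 - φ 0 0 * φ 1 2,
      φ 0 0 * φ 1 1 - φ 0 1 * φ 1 0], rfl, rfl, rfl⟩
  have hi : Indep3 m := by
    intro x y z hxyz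
    have := hφm x (-y) z (by
      simp only [minors23, Matrix.cons_val_zero, Matrix.cons_val_one, Matrix.cons_val, C_neg]
      rw [hm0, hm1, hm2] at hxyz
      linear_combination hxyz)
    simpa using this
  have heq : ∀ i k, v i 0 * φ 0 k + v i 1 * φ 1 k + (p i 0 * u 0 k + p i 1 * u 1 k) = 0 := by
    intro i k
    have := congrFun (congrFun h i) k
    simpa [Matrix.mul_apply, Fin.sum_univ_two, cmat_apply] using this
  have hum : ∀ j, u j 0 * m 0 + u j 1 * m 1 + u j 2 * m 2 = 0 := by
    obtain ⟨r, hr⟩ : ∃ r : Fin 2 → R3, ∀ j, r j = u j 0 * m 0 + u j 1 * m 1 + u j 2 * m 2 :=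
      ⟨_, fun _ => rfl⟩
    have e : ∀ i, p i 0 * r 0 + p i 1 * r 1 = 0 := by
      intro i
      rw [hr, hr, hm0, hm1, hm2]
      linear_combination (φ 0 1 * φ 1 2 - φ 0 2 * φ 1 1) * heq i 0 +
        (φ 0 2 * φ 1 0 - φ 0 0 * φ 1 2) * heq i 1 + (φ 0 0 * φ 1 1 - φ 0 1 * φ 1 0) * heq i 2
    have hne : p 0 0 * p 1 1 - p 0 1 * p 1 0 ≠ 0 := hpm.ne_zero 2
    intro j
    rw [← hr]
    apply mul_left_cancel₀ hne
    fin_cases j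
    · show _ * r 0 = _
      linear_combination p 1 1 * e 0 - p 0 1 * e 1
    · show _ * r 1 = _
      linear_combination p 0 0 * e 1 - p 1 0 * e 0
  have key : ∀ j, ∃ x y : ℂ, ∀ i, u j i = C x * φ 0 i + C y * φ 1 i := by
    intro j
    by_cases hfac : ∃ (l : R3) (m' : Fin 3 → R3), l.IsHomogeneous 1 ∧
        (∀ i, (m' i).IsHomogeneous 1) ∧ ∀ i, m i = l * m' i
    · obtain ⟨l, n, -, hn, hmn⟩ := hfac
      exact caseA (hφ 0) (hφ 1) hu hp m hm0 hm1 hm2 hi hum hpm heq hn hmn j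
    · exact caseB (hφ 0) (hφ 1) (hu j) m hm0 hm1 hm2 hi (hum j) hfac
  choose x y hxy using key
  refine ⟨Matrix.of fun j k => if k = 0 then x j else y j, ?_, ?_⟩
  · ext1 j k
    simp [Matrix.mul_apply, Fin.sum_univ_two, cmat_apply, hxy]
  · have hne := hi.ne_zero 2
    rw [hm2] at hne
    ext1 i k
    have e0 := heq i 0
    have e1 := heq i 1
    rw [hxy, hxy] at e0 e1
    have v0 : v i 0 = -(p i 0 * C (x 0) + p i 1 * C (x 1)) := by
      apply mul_left_cancel₀ hne
      linear_combination φ 1 1 * e0 - φ 1 0 * e1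
    have v1 : v i 1 = -(p i 0 * C (y 0) + p i 1 * C (y 1)) := by
      apply mul_left_cancel₀ hne
      linear_combination φ 0 0 * e1 - φ 0 1 * e0
    fin_cases k
    · simp [Matrix.mul_apply, Fin.sum_univ_two, cmat_apply]
      linear_combination v0
    · simp [Matrix.mul_apply, Fin.sum_univ_two, cmat_apply]
      linear_combination v1

/-- The linear map `A ↦ (A φ₁₁, - φ₂₂ A)`. -/
noncomputable def solMap (φ : Matrix (Fin 2) (Fin 3) R3) (p : Matrix (Fin 3) (Fin 2) R3) :
    Matrix (Fin 2) (Fin 2) ℂ →ₗ[ℂ] Matrix (Fin 2) (Fin 3) R3 × Matrix (Fin 3) (Fin 2) R3 where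
  toFun A := (cmat A * φ, -(p * cmat A))
  map_add' A B := by
    have : cmat (A + B) = cmat A + cmat B := by
      ext1 i j; simp [cmat_apply]
    rw [this, Matrix.add_mul, Matrix.mul_add, neg_add]; rfl
  map_smul' r A := by
    have : cmat (r • A) = r • cmat A := by
      ext1 i j; simp [cmat_apply, smul_eq_C_mul]
    rw [this, Matrix.smul_mul, Matrix.mul_smul, ← smul_neg]; rfl

lemma solMap_injective {φ : Matrix (Fin 2) (Fin 3) R3} (p : Matrix (Fin 3) (Fin 2) R3)
    (hφm : Indep3 (minors23 φ)) : Function.Injective (solMap φ p) := by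
  rw [← LinearMap.ker_eq_bot, LinearMap.ker_eq_bot']
  intro A hA
  have h1 : cmat A * φ = 0 := congrArg Prod.fst hA
  have hne : φ 0 0 * φ 1 1 - φ 0 1 * φ 1 0 ≠ 0 := hφm.ne_zero 2
  have e : ∀ j k, C (A j 0) * φ 0 k + C (A j 1) * φ 1 k = 0 := by
    intro j k
    have := congrFun (congrFun h1 j) k
    simpa [Matrix.mul_apply, Fin.sum_univ_two, cmat_apply] using this
  ext j k
  apply C_injective (Fin 3) ℂ
  rw [Matrix.zero_apply, C_0]
  apply mul_left_cancel₀ hne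
  fin_cases k
  · show _ * C (A j 0) = _ * 0
    linear_combination φ 1 1 * e j 0 - φ 1 0 * e j 1
  · show _ * C (A j 1) = _ * 0
    linear_combination φ 0 0 * e j 1 - φ 0 1 * e j 0

lemma solMap_isSol {φ : Matrix (Fin 2) (Fin 3) R3} {p : Matrix (Fin 3) (Fin 2) R3}
    (hφ : ∀ i j, (φ i j).IsHomogeneous 1) (hp : ∀ i j, (p i j).IsHomogeneous 1)
    (A : Matrix (Fin 2) (Fin 2) ℂ) : IsSol φ p (solMap φ p A) := by
  refine ⟨fun i j => ?_, fun i j => ?_, ?_⟩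
  · show ((cmat A * φ) i j).IsHomogeneous 1
    simp only [Matrix.mul_apply, Fin.sum_univ_two, cmat_apply]
    exact ((hφ 0 j).C_mul _).add ((hφ 1 j).C_mul _)
  · show ((-(p * cmat A)) i j).IsHomogeneous 1
    simp only [Matrix.neg_apply, Matrix.mul_apply, Fin.sum_univ_two, cmat_apply]
    rw [mul_comm (p i 0), mul_comm (p i 1)]
    exact (((hp i 0).C_mul _).add ((hp i 1).C_mul _)).neg
  · show -(p * cmat A) * φ + p * (cmat A * φ) = 0
    rw [Matrix.neg_mul, Matrix.mul_assoc, neg_add_cancel]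

/-- If the maximal minors of the 2×3 matrix of linear forms `φ₁₁` are linearly independent
over `ℂ`, and likewise for the 3×2 matrix `φ₂₂`, then the space `K(φ₁₁,φ₂₂)` of pairs
`(u,v)` of matrices of linear forms with `v·φ₁₁ + φ₂₂·u = 0` has dimension 4 over `ℂ`. -/
theorem stmt2 (φ₁₁ : Matrix (Fin 2) (Fin 3) R3) (φ₂₂ : Matrix (Fin 3) (Fin 2) R3)
    (h11L : ∀ i j, (φ₁₁ i j).IsHomogeneous 1) (h22L : ∀ i j, (φ₂₂ i j).IsHomogeneous 1)
    (h11m : LinearIndependent ℂ (minors23 φ₁₁))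
    (h22m : LinearIndependent ℂ (minors32 φ₂₂)) :
    ∃ bas : Fin 4 → Matrix (Fin 2) (Fin 3) R3 × Matrix (Fin 3) (Fin 2) R3,
      LinearIndependent ℂ bas ∧ (∀ k, IsSol φ₁₁ φ₂₂ (bas k)) ∧
      ∀ p, IsSol φ₁₁ φ₂₂ p → p ∈ Submodule.span ℂ (Set.range bas) := by
  let b := (Matrix.stdBasis ℂ (Fin 2) (Fin 2)).reindex (finProdFinEquiv (m := 2) (n := 2))
  have h1 := indep3_of h11m
  have h2 := indep3_of h22m
  refine ⟨fun k => solMap φ₁₁ φ₂₂ (b k), ?_, fun k => solMap_isSol h11L h22L _, ?_⟩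
  · exact b.linearIndependent.map' _ (LinearMap.ker_eq_bot.mpr (solMap_injective φ₂₂ h1))
  · rintro ⟨u, v⟩ ⟨hu, -, h⟩
    obtain ⟨A, rfl, rfl⟩ := sol_trivial h11L h22L h1 h2 hu h
    have hr : Set.range (fun k => solMap φ₁₁ φ₂₂ (b k)) = solMap φ₁₁ φ₂₂ '' Set.range b :=
      Set.range_comp _ _
    have hA : solMap φ₁₁ φ₂₂ A ∈ Submodule.span ℂ (Set.range fun k => solMap φ₁₁ φ₂₂ (b k)) := by
      rw [hr, Submodule.span_image, b.span_eq]
      exact Submodule.mem_map_of_mem Submodule.mem_top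
    exact hA
end
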